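/- Let α be irrational with 0 < α < 1. Then every integer q ≥ 1 has a unique expansion q = Σ_{k=1}^n c_k q_{k−1} with integer coefficients satisfying c_n ≥ 1, 0 ≤ c_k ≤ a_k − 1 for 1 ≤ k ≤ n, and such that for no pair of indices i < j the consecutive block (c_i, c_{i+1}, …, c_j) equals (a_i − 1, a_{i+1} − 2, a_{i+2} − 2, …, a_{j−1} − 2, a_j − 1). -/

import Mathlib

open Filter Finset

/-- Distance from `x` to the nearest integer. -/
noncomputable def nint (x : ℝ) : ℝ := |x - (round x : ℝ)|

/-- One-sided inhomogeneous approximation constant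
`M₊(α,β) = liminf_{q→∞} q‖qα−β‖` over positive integers `q`. -/
noncomputable def Mplus (α β : ℝ) : ℝ :=
  Filter.liminf (fun q : ℕ => (q : ℝ) * nint (q * α - β)) Filter.atTop

/-- Complete quotients of the negative continued fraction: `ncq α i = α_{i+1}`,
so `ncq α 0 = α₁ = α` and `α_{i+1} = a_i - 1/α_i` with `a_i = ⌈1/α_i⌉`. -/
noncomputable def ncq (α : ℝ) : ℕ → ℝ
  | 0 => α
  | i + 1 => (⌈(ncq α i)⁻¹⌉ : ℝ) - (ncq α i)⁻¹

/-- Partial quotients of the negative continued fraction: `npq α i = a_i = ⌈1/α_i⌉` for `i ≥ 1`. -/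
noncomputable def npq (α : ℝ) (i : ℕ) : ℤ := ⌈(ncq α (i - 1))⁻¹⌉

/-- Convergent denominators: `q₀ = 1`, `q₁ = a₁`, `q_{i+2} = a_{i+2} q_{i+1} − q_i`. -/
noncomputable def nq (α : ℝ) : ℕ → ℤ
  | 0 => 1
  | 1 => npq α 1
  | i + 2 => npq α (i + 2) * nq α (i + 1) - nq α i

/-- Convergent numerators: `p₀ = 0`, `p₁ = 1`, `p_{i+2} = a_{i+2} p_{i+1} − p_i`. -/
noncomputable def np (α : ℝ) : ℕ → ℤ
  | 0 => 0
  | 1 => 1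
  | i + 2 => npq α (i + 2) * np α (i + 1) - np α i

/-- `Dk α k = α₁α₂⋯α_k` (with `Dk α 0 = 1`). -/
noncomputable def Dk (α : ℝ) (k : ℕ) : ℝ := ∏ j ∈ Finset.range k, ncq α j

/-- Davenport remainders: `drem α β i = β_{i+1}`, so `drem α β 0 = β₁ = β` and
`β_{i+1} = β_i/α_i − ⌊β_i/α_i⌋`. -/
noncomputable def drem (α β : ℝ) : ℕ → ℝ
  | 0 => β
  | i + 1 => Int.fract (drem α β i / ncq α i)

/-- Davenport coefficients: `db α β i = b_i = ⌊β_i/α_i⌋` for `i ≥ 1`. -/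
noncomputable def db (α β : ℝ) (i : ℕ) : ℤ := ⌊drem α β (i - 1) / ncq α (i - 1)⌋

/-- `Qn α β n = Σ_{k=1}^n b_k q_{k−1}`. -/
noncomputable def Qn (α β : ℝ) (n : ℕ) : ℤ :=
  ∑ k ∈ Finset.Icc 1 n, db α β k * nq α (k - 1)

/-- `Q′_n`. -/
noncomputable def Qn' (α β : ℝ) (n : ℕ) : ℤ :=
  if Qn α β n < nq α n - nq α (n - 1) then Qn α β n + nq α (n - 1)
  else Qn α β n + nq α (n - 1) - nq α n

/-- `λ_n(β) = Q_n D_n β_{n+1}`. -/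
noncomputable def lam (α β : ℝ) (n : ℕ) : ℝ :=
  (Qn α β n : ℝ) * Dk α n * drem α β n

/-- `ρ_n(β)`. -/
noncomputable def rho (α β : ℝ) (n : ℕ) : ℝ :=
  if Qn α β n < nq α n - nq α (n - 1)
  then (Qn' α β n : ℝ) * Dk α n * (1 - drem α β n)
  else (Qn' α β n : ℝ) * Dk α n * (1 - ncq α n - drem α β n)

/-- Reversed quotients: `ᾱ₀ = 0`, `ᾱ_i = 1/(a_i − ᾱ_{i−1})`. -/
noncomputable def rq (α : ℝ) : ℕ → ℝ
  | 0 => 0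
  | i + 1 => ((npq α (i + 1) : ℝ) - rq α i)⁻¹
theorem ncq_mem_Ioo {α : ℝ} (hirr : Irrational α) (h0 : 0 < α) (h1 : α < 1) (i : ℕ) :
    Irrational (ncq α i) ∧ 0 < ncq α i ∧ ncq α i < 1 := by
  induction i with
  | zero => exact ⟨hirr, h0, h1⟩
  | succ i ih =>
    have hinv : Irrational (ncq α i)⁻¹ := ih.1.inv
    refine ⟨hinv.intCast_sub _, ?_, ?_⟩
    · have := lt_of_le_of_ne (Int.le_ceil (ncq α i)⁻¹) (hinv.ne_int _)
      simpa [ncq] using this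
    · have := Int.ceil_lt_add_one (ncq α i)⁻¹
      simp only [ncq]
      linarith

theorem two_le_npq {α : ℝ} (hirr : Irrational α) (h0 : 0 < α) (h1 : α < 1) (i : ℕ) :
    2 ≤ npq α i := by
  obtain ⟨-, hpos, hlt⟩ := ncq_mem_Ioo hirr h0 h1 (i - 1)
  have : (1 : ℤ) < npq α i := by
    rw [npq, Int.lt_ceil]
    exact_mod_cast (one_lt_inv₀ hpos).2 hlt
  omega

/-- The convergent denominator preceding `nq α n`, with the convention `q₋₁ = 0`. -/
noncomputable def nqPrev (α : ℝ) : ℕ → ℤ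
  | 0 => 0
  | n + 1 => nq α n

theorem nqPrev_succ (α : ℝ) (n : ℕ) : nqPrev α (n + 1) = nq α n := rfl

theorem nq_succ (α : ℝ) (n : ℕ) :
    nq α (n + 1) = npq α (n + 1) * nq α n - nqPrev α n := by
  cases n <;> simp [nq, nqPrev]

theorem nqPrev_nonneg_and_lt {α : ℝ} (ha : ∀ i, 2 ≤ npq α i) (n : ℕ) :
    0 ≤ nqPrev α n ∧ nqPrev α n < nq α n := by
  induction n with
  | zero => simp [nq, nqPrev]
  | succ n ih =>
    rw [nq_succ]
    refine ⟨by simp only [nqPrev_succ]; omega, ?_⟩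
    simp only [nqPrev_succ]
    nlinarith [ha (n + 1)]

theorem natCast_lt_nq {α : ℝ} (ha : ∀ i, 2 ≤ npq α i) (n : ℕ) : (n : ℤ) < nq α n := by
  induction n with
  | zero => simp [nq]
  | succ n ih =>
    have := (nqPrev_nonneg_and_lt ha (n + 1)).2
    simp only [nqPrev_succ] at this
    push_cast
    omega

/-- The digits `c₁, …, c_n` end in a block `(a_i − 1, a_{i+1} − 2, …, a_n − 2)`. -/
def EndsTight (α : ℝ) (c : ℕ → ℤ) (n : ℕ) : Prop :=
  ∃ i, 1 ≤ i ∧ i ≤ n ∧ c i = npq α i - 1 ∧ ∀ k, i < k → k ≤ n → c k = npq α k - 2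

theorem not_endsTight_zero (α : ℝ) (c : ℕ → ℤ) : ¬ EndsTight α c 0 := by
  rintro ⟨i, h1, h2, -⟩
  omega

theorem endsTight_succ {α : ℝ} {c : ℕ → ℤ} {n : ℕ} :
    EndsTight α c (n + 1) ↔
      c (n + 1) = npq α (n + 1) - 1 ∨ EndsTight α c n ∧ c (n + 1) = npq α (n + 1) - 2 := by
  constructor
  · rintro ⟨i, hi, hin, hci, hk⟩
    rcases hin.lt_or_eq with h | rfl
    · exact Or.inr ⟨⟨i, hi, by omega, hci, fun k h1 h2 => hk k h1 (by omega)⟩,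
        hk _ h le_rfl⟩
    · exact Or.inl hci
  · rintro (h | ⟨⟨i, hi, hin, hci, hk⟩, h⟩)
    · exact ⟨n + 1, by omega, le_rfl, h, fun k h1 h2 => by omega⟩
    · refine ⟨i, hi, by omega, hci, fun k h1 h2 => ?_⟩
      rcases h2.lt_or_eq with h3 | rfl
      · exact hk k h1 (by omega)
      · exact h

theorem endsTight_congr {α : ℝ} {c d : ℕ → ℤ} {n : ℕ} (h : ∀ k ≤ n, c k = d k) :
    EndsTight α c n ↔ EndsTight α d n := by
  induction n with
  | zero => simp [not_endsTight_zero]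
  | succ n ih =>
    rw [endsTight_succ, endsTight_succ, ih fun k hk => h k (by omega), h _ le_rfl]

/-- The digits `c₁, …, c_n` satisfy the digit bounds and contain no forbidden block. -/
def IsAdmissible (α : ℝ) (c : ℕ → ℤ) (n : ℕ) : Prop :=
  ∀ k < n, 0 ≤ c (k + 1) ∧ c (k + 1) ≤ npq α (k + 1) - 1 ∧
    (c (k + 1) = npq α (k + 1) - 1 → ¬ EndsTight α c k)

theorem isAdmissible_succ {α : ℝ} {c : ℕ → ℤ} {n : ℕ} :
    IsAdmissible α c (n + 1) ↔ IsAdmissible α c n ∧ 0 ≤ c (n + 1) ∧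
      c (n + 1) ≤ npq α (n + 1) - 1 ∧
      (c (n + 1) = npq α (n + 1) - 1 → ¬ EndsTight α c n) :=
  Nat.forall_lt_succ_right

theorem IsAdmissible.congr {α : ℝ} {c d : ℕ → ℤ} {n : ℕ} (hc : IsAdmissible α c n)
    (h : ∀ k ≤ n, c k = d k) : IsAdmissible α d n := by
  intro k hk
  rw [← h (k + 1) hk, ← endsTight_congr fun j hj => h j (by omega)]
  exact hc k hk

theorem isAdmissible_iff {α : ℝ} {c : ℕ → ℤ} {n : ℕ} :
    IsAdmissible α c n ↔
      (∀ k : ℕ, 1 ≤ k → k ≤ n → 0 ≤ c k ∧ c k ≤ npq α k - 1) ∧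
      (∀ i j : ℕ, 1 ≤ i → i < j → j ≤ n →
        ¬ (c i = npq α i - 1 ∧ (∀ k : ℕ, i < k → k < j → c k = npq α k - 2) ∧
            c j = npq α j - 1)) := by
  constructor
  · intro h
    refine ⟨fun k hk hkn => ?_, ?_⟩
    · obtain ⟨k, rfl⟩ := Nat.exists_eq_add_of_le' hk
      exact ⟨(h k hkn).1, (h k hkn).2.1⟩
    · rintro i j hi hij hjn ⟨hci, hk, hcj⟩
      obtain ⟨j, rfl⟩ := Nat.exists_eq_add_of_le' (show 1 ≤ j by omega)
      exact (h j hjn).2.2 hcj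
        ⟨i, hi, by omega, hci, fun k h1 h2 => hk k h1 (by omega)⟩
  · rintro ⟨hb, hf⟩ k hk
    refine ⟨(hb (k + 1) (by omega) hk).1, (hb (k + 1) (by omega) hk).2, ?_⟩
    rintro hck ⟨i, hi, hik, hci, hm⟩
    exact hf i (k + 1) hi (by omega) hk ⟨hci, fun m h1 h2 => hm m h1 (by omega), hck⟩

/-- The integer `Σ_{k=1}^n c_k q_{k−1}` with digits `c₁, …, c_n`. -/
noncomputable def digitSum (α : ℝ) (c : ℕ → ℤ) (n : ℕ) : ℤ :=
  ∑ k ∈ Finset.Icc 1 n, c k * nq α (k - 1)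

theorem digitSum_succ (α : ℝ) (c : ℕ → ℤ) (n : ℕ) :
    digitSum α c (n + 1) = digitSum α c n + c (n + 1) * nq α n := by
  simp [digitSum, Finset.sum_Icc_succ_top]

theorem digitSum_congr {α : ℝ} {c d : ℕ → ℤ} {n : ℕ} (h : ∀ k ≤ n, c k = d k) :
    digitSum α c n = digitSum α d n :=
  Finset.sum_congr rfl fun k hk => by rw [h k (Finset.mem_Icc.1 hk).2]

theorem IsAdmissible.digitSum_bounds {α : ℝ} (ha : ∀ i, 2 ≤ npq α i) {c : ℕ → ℤ} {n : ℕ}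
    (hc : IsAdmissible α c n) :
    0 ≤ digitSum α c n ∧ digitSum α c n < nq α n ∧
      (EndsTight α c n ↔ nq α n - nqPrev α n ≤ digitSum α c n) := by
  induction n with
  | zero => simp [digitSum, nq, nqPrev, not_endsTight_zero]
  | succ n ih =>
    obtain ⟨hc, hc0, hc1, hct⟩ := isAdmissible_succ.1 hc
    obtain ⟨hS0, hS1, hT⟩ := ih hc
    obtain ⟨hP, hPQ⟩ := nqPrev_nonneg_and_lt ha n
    rw [endsTight_succ, digitSum_succ, nq_succ, hT]
    rw [hT] at hct
    simp only [nqPrev_succ]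
    refine ⟨by nlinarith, ?_⟩
    rcases (show c (n + 1) = npq α (n + 1) - 1 ∨ c (n + 1) = npq α (n + 1) - 2 ∨
      c (n + 1) ≤ npq α (n + 1) - 3 by omega) with h | h | h
    · have := hct h
      rw [h]
      exact ⟨by linarith, by simp; linarith⟩
    · rw [h]
      refine ⟨by linarith, ?_⟩
      constructor
      · rintro (h' | h')
        · omega
        · linarith [h'.1]
      · intro h'
        exact Or.inr ⟨by linarith, rfl⟩
    · have hmul : c (n + 1) * nq α n ≤ (npq α (n + 1) - 3) * nq α n :=
        mul_le_mul_of_nonneg_right h (by omega)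
      refine ⟨by linarith, ?_⟩
      constructor
      · rintro (h' | h') <;> omega
      · intro h'
        linarith

theorem exists_isAdmissible {α : ℝ} (ha : ∀ i, 2 ≤ npq α i) (n : ℕ) {q : ℤ}
    (hq0 : 0 ≤ q) (hq : q < nq α n) :
    ∃ c : ℕ → ℤ, IsAdmissible α c n ∧ (∀ k, k = 0 ∨ n < k → c k = 0) ∧
      digitSum α c n = q := by
  induction n generalizing q with
  | zero =>
    refine ⟨0, fun k hk => by omega, fun _ _ => rfl, ?_⟩
    simp only [nq] at hq
    simp [digitSum]
    omega
  | succ n ih =>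
    obtain ⟨hP, hPQ⟩ := nqPrev_nonneg_and_lt ha n
    have hQ : 0 < nq α n := by omega
    have hr0 := Int.emod_nonneg q hQ.ne'
    have hr1 := Int.emod_lt_of_pos q hQ
    have hdiv := Int.emod_add_mul_ediv q (nq α n)
    obtain ⟨c, hc, hcz, hcs⟩ := ih hr0 hr1
    rw [nq_succ] at hq
    have hlt : q / nq α n < npq α (n + 1) := by
      by_contra! h
      nlinarith
    have hcd : ∀ k ≤ n, c k = Function.update c (n + 1) (q / nq α n) k := fun k hk => by
      rw [Function.update_of_ne (by omega)]
    refine ⟨Function.update c (n + 1) (q / nq α n), ?_, ?_, ?_⟩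
    · refine isAdmissible_succ.2 ⟨hc.congr hcd, ?_⟩
      rw [← endsTight_congr hcd, Function.update_self, (hc.digitSum_bounds ha).2.2, hcs]
      refine ⟨Int.ediv_nonneg hq0 hQ.le, by omega, fun h => ?_⟩
      rw [h] at hdiv
      linarith
    · intro k hk
      rw [Function.update_of_ne (by omega)]
      exact hcz k (by omega)
    · rw [digitSum_succ, ← digitSum_congr hcd, hcs, Function.update_self]
      linarith

theorem IsAdmissible.eq_of_digitSum_eq {α : ℝ} (ha : ∀ i, 2 ≤ npq α i) {c d : ℕ → ℤ} {n : ℕ}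
    (hc : IsAdmissible α c n) (hd : IsAdmissible α d n)
    (h : digitSum α c n = digitSum α d n) : ∀ k, 1 ≤ k → k ≤ n → c k = d k := by
  induction n with
  | zero => intro k h1 h2; omega
  | succ n ih =>
    replace hc := (isAdmissible_succ.1 hc).1
    replace hd := (isAdmissible_succ.1 hd).1
    obtain ⟨hc0, hc1, -⟩ := hc.digitSum_bounds ha
    obtain ⟨hd0, hd1, -⟩ := hd.digitSum_bounds ha
    rw [digitSum_succ, digitSum_succ] at h
    have hlast : c (n + 1) = d (n + 1) := by
      have hdiv := congrArg (· / nq α n) h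
      simpa [Int.add_mul_ediv_right _ _ (show nq α n ≠ 0 by omega),
        Int.ediv_eq_zero_of_lt, hc0, hc1, hd0, hd1] using hdiv
    rw [hlast] at h
    intro k h1 h2
    rcases h2.lt_or_eq with h3 | rfl
    · exact ih hc hd (by linarith) k h1 (by omega)
    · exact hlast

theorem IsAdmissible.extend {α : ℝ} (ha : ∀ i, 2 ≤ npq α i) {c : ℕ → ℤ} {n N : ℕ}
    (hc : IsAdmissible α c n) (hz : ∀ k, n < k → c k = 0) (hN : n ≤ N) :
    IsAdmissible α c N ∧ digitSum α c N = digitSum α c n := by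
  induction N, hN using Nat.le_induction with
  | base => exact ⟨hc, rfl⟩
  | succ N hN ih =>
    have h0 := hz (N + 1) (by omega)
    have := ha (N + 1)
    exact ⟨isAdmissible_succ.2 ⟨ih.1, by omega, by omega, fun h => by omega⟩,
      by rw [digitSum_succ, h0, ih.2]; ring⟩

/-- Every integer `q ≥ 1` has a unique Ostrowski expansion
`q = Σ_{k=1}^n c_k q_{k−1}` with `c_n ≥ 1`, `0 ≤ c_k ≤ a_k − 1` for `1 ≤ k ≤ n`, and no
consecutive block `(c_i, …, c_j)`, `i < j`, equal to
`(a_i − 1, a_{i+1} − 2, …, a_{j−1} − 2, a_j − 1)`.  (The coefficient function is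
normalized to vanish at `0` and beyond `n`, so the expansion is a unique pair `(n, c)`.) -/
theorem stmt11 (α : ℝ) (hirr : Irrational α) (h0 : 0 < α) (h1 : α < 1)
    (q : ℤ) (hq : 1 ≤ q) :
    ∃! nc : ℕ × (ℕ → ℤ),
      1 ≤ nc.1 ∧
      1 ≤ nc.2 nc.1 ∧
      (∀ k : ℕ, 1 ≤ k → k ≤ nc.1 → 0 ≤ nc.2 k ∧ nc.2 k ≤ npq α k - 1) ∧
      (∀ k : ℕ, k = 0 ∨ nc.1 < k → nc.2 k = 0) ∧
      (∀ i j : ℕ, 1 ≤ i → i < j → j ≤ nc.1 →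
        ¬ (nc.2 i = npq α i - 1 ∧ (∀ k : ℕ, i < k → k < j → nc.2 k = npq α k - 2) ∧
            nc.2 j = npq α j - 1)) ∧
      q = ∑ k ∈ Finset.Icc 1 nc.1, nc.2 k * nq α (k - 1) := by
  have ha := two_le_npq hirr h0 h1
  refine existsUnique_of_exists_of_unique ?_ ?_
  · obtain ⟨c, hc, hz, hs⟩ := exists_isAdmissible ha q.toNat (q := q) (by omega)
      (by have := natCast_lt_nq ha q.toNat; omega)
    have hne : ∃ k, c k ≠ 0 := by
      by_contra! h
      simp [digitSum, h] at hs
      omega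
    have hle : ∀ k, c k ≠ 0 → k ≤ q.toNat := fun k hk => by
      by_contra! h
      exact hk (hz k (Or.inr h))
    obtain ⟨k, hk⟩ := hne
    set n := Nat.findGreatest (fun k => c k ≠ 0) q.toNat
    have hn : c n ≠ 0 := Nat.findGreatest_spec (P := fun k => c k ≠ 0) (hle k hk) hk
    have hn1 : 1 ≤ n := Nat.one_le_iff_ne_zero.2 fun h => hn (hz n (Or.inl h))
    have hnz : ∀ k, n < k → c k = 0 := fun k hk => by
      by_contra h
      exact absurd (Nat.le_findGreatest (P := fun k => c k ≠ 0) (hle k h) h) (by omega)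
    have hcn : IsAdmissible α c n := fun k hk => hc k (by have := hle n hn; omega)
    obtain ⟨hb, hf⟩ := isAdmissible_iff.1 hcn
    refine ⟨(n, c), hn1, ?_, hb, ?_, hf, ?_⟩
    · have := (hb n hn1 le_rfl).1
      change 1 ≤ c n
      omega
    · rintro k (hk | hk)
      · exact hz k (Or.inl hk)
      · exact hnz k hk
    · rw [← hs]
      exact (hcn.extend ha hnz (hle n hn)).2
  · rintro ⟨n, c⟩ ⟨m, d⟩ ⟨hn, hcn, hcb, hcz, hcf, hcs⟩ ⟨hm, hdm, hdb, hdz, hdf, hds⟩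
    dsimp only at *
    obtain ⟨hc, hcs'⟩ := (isAdmissible_iff.2 ⟨hcb, hcf⟩).extend ha
      (fun k hk => hcz k (Or.inr hk)) (le_max_left n m)
    obtain ⟨hd, hds'⟩ := (isAdmissible_iff.2 ⟨hdb, hdf⟩).extend ha
      (fun k hk => hdz k (Or.inr hk)) (le_max_right n m)
    have heq := hc.eq_of_digitSum_eq ha hd (hcs'.trans (hcs.symm.trans (hds.trans hds'.symm)))
    have hcd : c = d := by
      funext k
      by_cases hk : 1 ≤ k ∧ k ≤ max n m
      · exact heq k hk.1 hk.2
      · rw [hcz k (by omega), hdz k (by omega)]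
    subst hcd
    have hnm : ¬ m < n := fun h => by
      have := hdz n (Or.inr h)
      omega
    have hmn : ¬ n < m := fun h => by
      have := hcz m (Or.inr h)
      omega
    rw [show n = m by omega]
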